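/- arXiv:2303.05160 — 4 statements merged into one kernel-verified Lean document; each statement's English description precedes it below -/
import Mathlib

section
/- If a pregroup P satisfies the left precyclic axiom q·p ≤ p·qˡˡ for all p, q ∈ P, then P collapses into a partially ordered group: for every x ∈ P one has xˡ = xʳ and x·xʳ = 1 = xʳ·x. -/
/-- If a pregroup satisfies the left precyclic axiom `q·p ≤ p·qˡˡ` for all `p, q`,
then it collapses into a partially ordered group: `xˡ = xʳ` and `x·xʳ = 1 = xʳ·x`. -/
theorem pregroup_left_precyclic_collapses_to_group
    {P : Type*} [Monoid P] [PartialOrder P]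
    (mul_le_mul_left' : ∀ a b c : P, b ≤ c → a * b ≤ a * c)
    (mul_le_mul_right' : ∀ a b c : P, b ≤ c → b * a ≤ c * a)
    (l r : P → P)
    (con_r : ∀ x : P, x * r x ≤ 1)
    (con_l : ∀ x : P, l x * x ≤ 1)
    (exp_r : ∀ x : P, 1 ≤ r x * x)
    (exp_l : ∀ x : P, 1 ≤ x * l x)
    (precyclic : ∀ p q : P, q * p ≤ p * l (l q)) :
    ∀ x : P, l x = r x ∧ x * r x = 1 ∧ r x * x = 1 := by
  have left_adjoint_le : ∀ x y : P, 1 ≤ x * y → l x ≤ y := fun x y h => by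
    have h₁ := mul_le_mul_left' (l x) _ _ h
    have h₂ := mul_le_mul_right' y _ _ (con_l x)
    rw [mul_one, ← mul_assoc] at h₁
    rw [one_mul] at h₂
    exact h₁.trans h₂
  have le_left_adjoint : ∀ x y : P, y * x ≤ 1 → y ≤ l x := fun x y h => by
    have h₁ := mul_le_mul_left' y _ _ (exp_l x)
    have h₂ := mul_le_mul_right' (l x) _ _ h
    rw [mul_one, ← mul_assoc] at h₁
    rw [one_mul] at h₂
    exact h₁.trans h₂
  have l_r : ∀ x, l (r x) = x := fun x =>
    le_antisymm (left_adjoint_le _ _ (exp_r x)) (le_left_adjoint _ _ (con_r x))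
  have le_l_l : ∀ x, x ≤ l (l x) := fun x => by simpa using precyclic 1 x
  have l_l_l : ∀ x, l (l (l x)) = l x := fun x =>
    le_antisymm
      (left_adjoint_le _ _ ((exp_l x).trans (mul_le_mul_right' _ _ _ (le_l_l x))))
      (le_l_l (l x))
  have l_l : ∀ x, l (l x) = x := fun x => by simpa only [l_r] using l_l_l (r x)
  have l_eq_r : ∀ x, l x = r x := fun x => by simpa only [l_r] using l_l (r x)
  have comm_le : ∀ p q : P, q * p ≤ p * q := fun p q => by
    simpa only [l_l] using precyclic p q
  intro x
  exact ⟨l_eq_r x,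
    le_antisymm (con_r x) ((exp_r x).trans (comm_le _ _)),
    le_antisymm ((comm_le _ _).trans (con_r x)) (exp_r x)⟩
end

section
/- If a pregroup P satisfies the right precyclic axiom q·p ≤ pʳʳ·q for all p, q ∈ P, then P collapses into a partially ordered group: for every x ∈ P one has xˡ = xʳ and x·xʳ = 1 = xʳ·x. -/
/-- If a pregroup satisfies the right precyclic axiom `q·p ≤ pʳʳ·q` for all `p, q`,
then it collapses into a partially ordered group: `xˡ = xʳ` and `x·xʳ = 1 = xʳ·x`. -/
theorem pregroup_right_precyclic_collapses_to_group
    {P : Type*} [Monoid P] [PartialOrder P]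
    (mul_le_mul_left' : ∀ a b c : P, b ≤ c → a * b ≤ a * c)
    (mul_le_mul_right' : ∀ a b c : P, b ≤ c → b * a ≤ c * a)
    (l r : P → P)
    (con_r : ∀ x : P, x * r x ≤ 1)
    (con_l : ∀ x : P, l x * x ≤ 1)
    (exp_r : ∀ x : P, 1 ≤ r x * x)
    (exp_l : ∀ x : P, 1 ≤ x * l x)
    (precyclic : ∀ p q : P, q * p ≤ r (r p) * q) :
    ∀ x : P, l x = r x ∧ x * r x = 1 ∧ r x * x = 1 := by
  have r_l : ∀ x, r (l x) = x := fun x => by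
    apply le_antisymm
    · calc r (l x) = 1 * r (l x) := (one_mul _).symm
        _ ≤ x * l x * r (l x) := mul_le_mul_right' _ _ _ (exp_l x)
        _ = x * (l x * r (l x)) := mul_assoc _ _ _
        _ ≤ x * 1 := mul_le_mul_left' _ _ _ (con_r (l x))
        _ = x := mul_one x
    · calc x = 1 * x := (one_mul _).symm
        _ ≤ r (l x) * l x * x := mul_le_mul_right' _ _ _ (exp_r (l x))
        _ = r (l x) * (l x * x) := mul_assoc _ _ _
        _ ≤ r (l x) * 1 := mul_le_mul_left' _ _ _ (con_l x)
        _ = r (l x) := mul_one _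
  have le_r_r : ∀ x, x ≤ r (r x) := fun x => by simpa using precyclic x 1
  have l_eq_r : ∀ x, l x = r x := fun x => by
    apply le_antisymm
    · simpa only [r_l] using le_r_r (l x)
    · calc r x = r x * 1 := (mul_one _).symm
        _ ≤ r x * (x * l x) := mul_le_mul_left' _ _ _ (exp_l x)
        _ ≤ r x * (r (r x) * l x) :=
          mul_le_mul_left' _ _ _ (mul_le_mul_right' _ _ _ (le_r_r x))
        _ = r x * r (r x) * l x := (mul_assoc _ _ _).symm
        _ ≤ 1 * l x := mul_le_mul_right' _ _ _ (con_r (r x))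
        _ = l x := one_mul _
  exact fun x => ⟨l_eq_r x, le_antisymm (con_r x) (l_eq_r x ▸ exp_l x),
    le_antisymm (l_eq_r x ▸ con_l x) (exp_r x)⟩
end

section
/- (Switching Lemma) Let P be a partially ordered set and let X, Y be strings over P with X ⇒ Y in the free pregroup on P. Then there exists a string U such that X ⇒ U is derivable without using any (EXP) steps, and U ⇒ Y is derivable without using any (CON) steps. -/
/-! Free pregroup rewriting over a partially ordered set `P`.
A term is a pair `(p, n) : P × ℤ` representing `p^(n)`; a string is a list of terms. -/

/-- (CON): `X, p^(n), p^(n+1), Y → X, Y`. -/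
inductive ConStep {P : Type*} [PartialOrder P] : List (P × ℤ) → List (P × ℤ) → Prop
  | con (X Y : List (P × ℤ)) (p : P) (n : ℤ) :
      ConStep (X ++ [(p, n), (p, n + 1)] ++ Y) (X ++ Y)

/-- (EXP): `X, Y → X, p^(n+1), p^(n), Y`. -/
inductive ExpStep {P : Type*} [PartialOrder P] : List (P × ℤ) → List (P × ℤ) → Prop
  | exp (X Y : List (P × ℤ)) (p : P) (n : ℤ) :
      ExpStep (X ++ Y) (X ++ [(p, n + 1), (p, n)] ++ Y)

/-- (IND): `X, p^(n), Y → X, q^(n), Y` whenever `p ≤ q` and `n` even, or `q ≤ p` and `n` odd. -/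
inductive IndStep {P : Type*} [PartialOrder P] : List (P × ℤ) → List (P × ℤ) → Prop
  | ind (X Y : List (P × ℤ)) (p q : P) (n : ℤ)
      (h : (p ≤ q ∧ Even n) ∨ (q ≤ p ∧ Odd n)) :
      IndStep (X ++ [(p, n)] ++ Y) (X ++ [(q, n)] ++ Y)

/-- A rewriting step of the free pregroup: (CON), (EXP) or (IND). -/
def Step {P : Type*} [PartialOrder P] (a b : List (P × ℤ)) : Prop :=
  ConStep a b ∨ ExpStep a b ∨ IndStep a b

/-- The order on terms `p^(n)`, `q^(n)` of equal exponent that governs (IND). -/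
def TermLe {P : Type*} [PartialOrder P] (n : ℤ) (p q : P) : Prop :=
  (p ≤ q ∧ Even n) ∨ (q ≤ p ∧ Odd n)

theorem TermLe.trans {P : Type*} [PartialOrder P] {n : ℤ} {p q r : P}
    (hpq : TermLe n p q) (hqr : TermLe n q r) : TermLe n p r := by
  rcases hpq with ⟨h, hn⟩ | ⟨h, hn⟩ <;> rcases hqr with ⟨h', hn'⟩ | ⟨h', hn'⟩
  · exact Or.inl ⟨h.trans h', hn⟩
  · exact absurd hn (Int.not_even_iff_odd.2 hn')
  · exact absurd hn' (Int.not_even_iff_odd.2 hn)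
  · exact Or.inr ⟨h'.trans h, hn⟩

theorem termLe_refl {P : Type*} [PartialOrder P] (n : ℤ) (p : P) : TermLe n p p :=
  (Int.even_or_odd n).imp (⟨le_rfl, ·⟩) (⟨le_rfl, ·⟩)

theorem termLe_succ_iff {P : Type*} [PartialOrder P] {n : ℤ} {p q : P} :
    TermLe (n + 1) p q ↔ TermLe n q p := by
  have hodd : Odd (n + 1) ↔ Even n := by
    rw [← Int.not_even_iff_odd, Int.even_add_one, not_not]
  simp only [TermLe, hodd, Int.even_add_one, Int.not_even_iff_odd]
  exact or_comm

/-- Generalized expansion: an (EXP) step followed by an (IND) step on the inserted pair. -/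
inductive GenExpStep {P : Type*} [PartialOrder P] : List (P × ℤ) → List (P × ℤ) → Prop
  | mk (X Y : List (P × ℤ)) (p q : P) (n : ℤ) (h : TermLe n p q) :
      GenExpStep (X ++ Y) (X ++ (p, n + 1) :: (q, n) :: Y)

theorem ExpStep.genExpStep {P : Type*} [PartialOrder P] {a b : List (P × ℤ)}
    (h : ExpStep a b) : GenExpStep a b := by
  obtain ⟨X, Y, p, n⟩ := h
  simpa using GenExpStep.mk X Y p p n (termLe_refl n p)

theorem IndStep.of_termLe {P : Type*} [PartialOrder P] (X Y : List (P × ℤ)) {p q : P} {n : ℤ}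
    (h : TermLe n p q) : IndStep (X ++ (p, n) :: Y) (X ++ (q, n) :: Y) := by
  simpa using IndStep.ind X Y p q n h

theorem GenExpStep.reflTransGen {P : Type*} [PartialOrder P] {a b : List (P × ℤ)}
    (h : GenExpStep a b) :
    Relation.ReflTransGen (fun a b => ExpStep a b ∨ IndStep a b) a b := by
  obtain ⟨X, Y, p, q, n, h⟩ := h
  have hexp : ExpStep (X ++ Y) (X ++ (q, n + 1) :: (q, n) :: Y) := by
    simpa using ExpStep.exp X Y q n
  have hind := IndStep.of_termLe X ((q, n) :: Y) (termLe_succ_iff.2 h)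
  exact .tail (.single (Or.inl hexp)) (Or.inr hind)

theorem GenExpStep.switch_con {P : Type*} [PartialOrder P] {a b c : List (P × ℤ)}
    (hab : GenExpStep a b) (hbc : ConStep b c) :
    ∃ d, (ConStep a d ∨ IndStep a d) ∧ Relation.ReflGen GenExpStep d c := by
  obtain ⟨A, B, p, q, n, h⟩ := hab
  generalize hb : A ++ (p, n + 1) :: (q, n) :: B = b at hbc
  obtain ⟨X, Y, r, m⟩ := hbc
  rw [List.append_assoc, List.append_eq_append_iff] at hb
  rcases hb with ⟨as, rfl, hb⟩ | ⟨as, rfl, hb⟩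
  · rcases as with _ | ⟨s, _ | ⟨t, as⟩⟩
    · simp only [List.nil_append, List.cons_append, List.cons.injEq, Prod.mk.injEq] at hb
      omega
    · simp only [List.nil_append, List.cons_append, List.cons.injEq, Prod.mk.injEq] at hb
      obtain ⟨rfl, ⟨rfl, rfl⟩, rfl⟩ := hb
      refine ⟨_, Or.inr (IndStep.of_termLe A Y (termLe_succ_iff.2 h)), ?_⟩
      simpa using Relation.ReflGen.refl
    · simp only [List.nil_append, List.cons_append, List.cons.injEq] at hb
      obtain ⟨rfl, rfl, rfl⟩ := hb
      refine ⟨A ++ as ++ Y, Or.inl ?_, Relation.ReflGen.single ?_⟩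
      · simpa using ConStep.con (A ++ as) Y r m
      · simpa using GenExpStep.mk A (as ++ Y) p q n h
  · rcases as with _ | ⟨s, _ | ⟨t, as⟩⟩
    · simp only [List.nil_append, List.cons_append, List.cons.injEq, Prod.mk.injEq] at hb
      omega
    · simp only [List.nil_append, List.cons_append, List.cons.injEq, Prod.mk.injEq] at hb
      obtain ⟨rfl, ⟨rfl, hm⟩, rfl⟩ := hb
      obtain rfl : m = n := by omega
      refine ⟨_, Or.inr ?_, Relation.ReflGen.refl⟩
      simpa using IndStep.of_termLe X B h
    · simp only [List.nil_append, List.cons_append, List.cons.injEq] at hb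
      obtain ⟨rfl, rfl, rfl⟩ := hb
      refine ⟨X ++ (as ++ B), Or.inl ?_, Relation.ReflGen.single ?_⟩
      · simpa using ConStep.con X (as ++ B) r m
      · simpa using GenExpStep.mk (X ++ as) B p q n h

theorem GenExpStep.switch_ind {P : Type*} [PartialOrder P] {a b c : List (P × ℤ)}
    (hab : GenExpStep a b) (hbc : IndStep b c) :
    ∃ d, Relation.ReflGen IndStep a d ∧ GenExpStep d c := by
  obtain ⟨A, B, p, q, n, h⟩ := hab
  generalize hb : A ++ (p, n + 1) :: (q, n) :: B = b at hbc
  obtain ⟨X, Y, r, s, m, hrs⟩ := hbc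
  change TermLe m r s at hrs
  rw [List.append_assoc, List.append_eq_append_iff] at hb
  rcases hb with ⟨as, rfl, hb⟩ | ⟨as, rfl, hb⟩
  · rcases as with _ | ⟨t, _ | ⟨u, as⟩⟩
    · simp only [List.nil_append, List.cons_append, List.cons.injEq, Prod.mk.injEq] at hb
      obtain ⟨⟨rfl, rfl⟩, rfl⟩ := hb
      refine ⟨_, Relation.ReflGen.refl, ?_⟩
      simpa using GenExpStep.mk A B s q n ((termLe_succ_iff.1 hrs).trans h)
    · simp only [List.nil_append, List.cons_append, List.cons.injEq, Prod.mk.injEq] at hb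
      obtain ⟨rfl, ⟨rfl, rfl⟩, rfl⟩ := hb
      refine ⟨_, Relation.ReflGen.refl, ?_⟩
      simpa using GenExpStep.mk A B p s n (h.trans hrs)
    · simp only [List.nil_append, List.cons_append, List.cons.injEq] at hb
      obtain ⟨rfl, rfl, rfl⟩ := hb
      refine ⟨A ++ (as ++ (s, m) :: Y), Relation.ReflGen.single ?_, ?_⟩
      · simpa using IndStep.of_termLe (A ++ as) Y hrs
      · simpa using GenExpStep.mk A (as ++ (s, m) :: Y) p q n h
  · rcases as with _ | ⟨t, as⟩
    · simp only [List.nil_append, List.cons_append, List.cons.injEq, Prod.mk.injEq] at hb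
      obtain ⟨⟨rfl, rfl⟩, rfl⟩ := hb
      refine ⟨_, Relation.ReflGen.refl, ?_⟩
      simpa using GenExpStep.mk X B s q n ((termLe_succ_iff.1 hrs).trans h)
    · simp only [List.nil_append, List.cons_append, List.cons.injEq] at hb
      obtain ⟨rfl, rfl⟩ := hb
      refine ⟨X ++ (s, m) :: (as ++ B), Relation.ReflGen.single ?_, ?_⟩
      · simpa using IndStep.of_termLe X (as ++ B) hrs
      · simpa using GenExpStep.mk (X ++ (s, m) :: as) B p q n h

theorem GenExpStep.switch_reflTransGen {P : Type*} [PartialOrder P] {a b c : List (P × ℤ)}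
    (hab : GenExpStep a b)
    (hbc : Relation.ReflTransGen (fun a b => ConStep a b ∨ IndStep a b) b c) :
    ∃ d, Relation.ReflTransGen (fun a b => ConStep a b ∨ IndStep a b) a d ∧
      Relation.ReflGen GenExpStep d c := by
  induction hbc with
  | refl => exact ⟨a, .refl, .single hab⟩
  | @tail c e _ hce ih =>
    obtain ⟨d, had, hdc⟩ := ih
    cases hdc with
    | refl => exact ⟨e, had.tail hce, .refl⟩
    | single hdc =>
      rcases hce with hce | hce
      · obtain ⟨f, hdf, hfe⟩ := hdc.switch_con hce
        exact ⟨f, had.tail hdf, hfe⟩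
      · obtain ⟨f, hdf, hfe⟩ := hdc.switch_ind hce
        cases hdf with
        | refl => exact ⟨d, had, .single hfe⟩
        | single hdf => exact ⟨f, had.tail (Or.inr hdf), .single hfe⟩

/-- (Switching Lemma) If `X ⇒ Y` in the free pregroup on `P`, then there is a string `U`
such that `X ⇒ U` is derivable without (EXP) steps and `U ⇒ Y` without (CON) steps. -/
theorem switching_lemma {P : Type*} [PartialOrder P] (X Y : List (P × ℤ))
    (h : Relation.ReflTransGen Step X Y) :
    ∃ U : List (P × ℤ),
      Relation.ReflTransGen (fun a b => ConStep a b ∨ IndStep a b) X U ∧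
      Relation.ReflTransGen (fun a b => ExpStep a b ∨ IndStep a b) U Y := by
  induction h using Relation.ReflTransGen.head_induction_on with
  | refl => exact ⟨Y, .refl, .refl⟩
  | head hstep _ ih =>
    obtain ⟨U, hU, hUY⟩ := ih
    rcases hstep with hc | he | hi
    · exact ⟨U, hU.head (Or.inl hc), hUY⟩
    · obtain ⟨V, hV, hVU⟩ := he.genExpStep.switch_reflTransGen hU
      cases hVU with
      | refl => exact ⟨_, hV, hUY⟩
      | single hVU => exact ⟨V, hV, hVU.reflTransGen.trans hUY⟩
    · exact ⟨U, hU.head (Or.inr hi), hUY⟩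
end

section
/- In the free pregroup on the two-element discrete partially ordered set P = {p, q} (no relations other than reflexivity), the string p^(0), q^(2), p^(−1), q^(1) (i.e. p·qʳʳ·pˡ·qʳ) is NOT nullable: it does not rewrite to the empty string. -/
/-- The two-element discrete partially ordered set `{p, q}`. -/
inductive Two : Type
  | p : Two
  | q : Two

/-- The discrete order on `Two`: `x ≤ y` iff `x = y`. -/
instance : PartialOrder Two where
  le x y := x = y
  le_refl _ := rfl
  le_trans _ _ _ h₁ h₂ := Eq.trans h₁ h₂
  le_antisymm _ _ h _ := h

/-- Two non-commuting transpositions of `Fin 3`, indexed by `Two`. -/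
def Two.transposition : Two → Equiv.Perm (Fin 3)
  | .p => Equiv.swap 0 1
  | .q => Equiv.swap 1 2

theorem Two.transposition_mul_self (x : Two) : x.transposition * x.transposition = 1 := by
  cases x <;> exact Equiv.swap_mul_self _ _

/-- The product in `S₃` obtained by sending each term `x^(n)` to `x.transposition`. -/
def transpositionProd (l : List (Two × ℤ)) : Equiv.Perm (Fin 3) :=
  (l.map fun t => t.1.transposition).prod

/-- On the discrete order, rewriting steps preserve `transpositionProd`. -/
theorem Step.transpositionProd_eq {a b : List (Two × ℤ)} (h : Step a b) :
    transpositionProd a = transpositionProd b := by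
  rcases h with ⟨X, Y, x, n⟩ | ⟨X, Y, x, n⟩ | ⟨X, Y, x, y, n, h⟩
  · simp [transpositionProd, ← mul_assoc x.transposition, Two.transposition_mul_self]
  · simp [transpositionProd, ← mul_assoc x.transposition, Two.transposition_mul_self]
  · obtain rfl : x = y := h.elim (fun h => h.1) (fun h => Eq.symm h.1)
    rfl

theorem transpositionProd_eq_of_reflTransGen {a b : List (Two × ℤ)}
    (h : Relation.ReflTransGen Step a b) : transpositionProd a = transpositionProd b := by
  induction h with
  | refl => rfl
  | tail _ hs ih => exact ih.trans hs.transpositionProd_eq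

/-- In the free pregroup on the two-element discrete poset `{p, q}`, the string
`p^(0), q^(2), p^(−1), q^(1)` (i.e. `p·qʳʳ·pˡ·qʳ`) is not nullable. -/
theorem not_nullable_pqq :
    ¬ Relation.ReflTransGen Step
        [(Two.p, (0 : ℤ)), (Two.q, (2 : ℤ)), (Two.p, (-1 : ℤ)), (Two.q, (1 : ℤ))]
        ([] : List (Two × ℤ)) := by
  intro h
  have h_prod := transpositionProd_eq_of_reflTransGen h
  revert h_prod
  decide
end
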